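/- Let M be a complex manifold, S a closed subset, U_0 = M ∖ S, U_1 a neighborhood of S, and 𝒰 = {U_0, U_1}. (1) The map E^{p,q}_{BC}(𝒰) → E^{p,q}(𝒰) given by (σ_0, σ_1, σ_{01}) ↦ (σ_0, σ_1, ∂σ_{01}) induces a homomorphism H^{p,q}_{BC}(𝒰) → H^{p,q}_{∂̄ϑ}(𝒰) from Čech-Bott-Chern to Čech-Dolbeault cohomology, compatible with the natural map H^{p,q}_{BC}(M) → H^{p,q}_{∂̄}(M) under the canonical isomorphisms H^{p,q}_{BC}(M) ≅ H^{p,q}_{BC}(𝒰) and H^{p,q}_{∂̄}(M) ≅ H^{p,q}_{∂̄ϑ}(𝒰). (2) The map E^{p,q}_{BC}(𝒰, U_0) → E^{p,q}(𝒰, U_0) given by (σ_1, σ_{01}) ↦ (σ_1, ∂σ_{01}) induces a homomorphism H^{p,q}_{BC}(𝒰, U_0) → H^{p,q}_{∂̄ϑ}(𝒰, U_0) on relative cohomologies. -/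

import Mathlib

/-!
Statement 8 (Proposition 3.13 of the paper).  Let `M` be a complex manifold, `S` a closed
subset, `U₀ = M ∖ S`, `U₁` a neighborhood of `S`, `𝒰 = {U₀, U₁}`.
(1) The map `E^{p,q}_{BC}(𝒰) → E^{p,q}(𝒰)`, `(σ₀, σ₁, σ₀₁) ↦ (σ₀, σ₁, ∂σ₀₁)` induces a
homomorphism `H^{p,q}_{BC}(𝒰) → H^{p,q}_{∂̄ϑ}(𝒰)` from Čech–Bott–Chern to Čech–Dolbeault
cohomology, compatible with the natural map `H^{p,q}_{BC}(M) → H^{p,q}_{∂̄}(M)` under the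
canonical isomorphisms `H^{p,q}_{BC}(M) ≅ H^{p,q}_{BC}(𝒰)`, `H^{p,q}_{∂̄}(M) ≅ H^{p,q}_{∂̄ϑ}(𝒰)`.
(2) The map `E^{p,q}_{BC}(𝒰,U₀) → E^{p,q}(𝒰,U₀)`, `(σ₁, σ₀₁) ↦ (σ₁, ∂σ₀₁)` induces a
homomorphism `H^{p,q}_{BC}(𝒰,U₀) → H^{p,q}_{∂̄ϑ}(𝒰,U₀)` on relative cohomologies.

The sheaves of forms are modelled abstractly by `DoubleFormSheaf`; see the definitions of
the Čech–Bott–Chern and Čech–Dolbeault (relative) cohomologies in this file.  The maps are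
characterized on classes of cocycles, and `H^{p,q}_{BC}(M)`, `H^{p,q}_{∂̄}(M)` are realized
as `HBCopen F ⊤`, `HDopen F ⊤`, with the canonical isomorphisms induced by `ω ↦ (ω, ω, 0)`.
-/

open TopologicalSpace

universe u

section LinearHelpers

variable {A B C S : Type u} [AddCommGroup A] [Module ℂ A] [AddCommGroup B] [Module ℂ B]
  [AddCommGroup C] [Module ℂ C] [AddCommGroup S] [Module ℂ S]

/-- a linear map into a triple product -/
def lmTri (f : S →ₗ[ℂ] A) (g : S →ₗ[ℂ] B) (h : S →ₗ[ℂ] C) : S →ₗ[ℂ] A × B × C :=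
  LinearMap.prod f (LinearMap.prod g h)

/-- first projection of a triple product -/
def pA : A × B × C →ₗ[ℂ] A := LinearMap.fst ℂ A (B × C)

/-- second projection of a triple product -/
def pB : A × B × C →ₗ[ℂ] B := (LinearMap.fst ℂ B C).comp (LinearMap.snd ℂ A (B × C))

/-- third projection of a triple product -/
def pC : A × B × C →ₗ[ℂ] C := (LinearMap.snd ℂ B C).comp (LinearMap.snd ℂ A (B × C))

/-- first projection of a pair -/
def qA : A × B →ₗ[ℂ] A := LinearMap.fst ℂ A B

/-- second projection of a pair -/
def qB : A × B →ₗ[ℂ] B := LinearMap.snd ℂ A B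

end LinearHelpers

/-- The cohomology of a pair of composable linear maps `f : A → B`, `g : B → C` with
`g ∘ f = 0` (in the situations where this is used):  `Ker g / Im f`. -/
abbrev cohomOf {A B C : Type u} [AddCommGroup A] [Module ℂ A] [AddCommGroup B] [Module ℂ B]
    [AddCommGroup C] [Module ℂ C] (f : A →ₗ[ℂ] B) (g : B →ₗ[ℂ] C) : Type u :=
  ↥(LinearMap.ker g) ⧸ (Submodule.comap (LinearMap.ker g).subtype (LinearMap.range f))

/-- The cohomology class of a cocycle. -/
def cohomMk {A B C : Type u} [AddCommGroup A] [Module ℂ A] [AddCommGroup B] [Module ℂ B]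
    [AddCommGroup C] [Module ℂ C] (f : A →ₗ[ℂ] B) (g : B →ₗ[ℂ] C) (b : B) (hb : g b = 0) :
    cohomOf f g :=
  Submodule.Quotient.mk ⟨b, LinearMap.mem_ker.mpr hb⟩

/-- The sheaves `E^{p,q}` of `C^∞` differential forms of type `(p,q)` on (the underlying
topological space of) a complex manifold, encoded abstractly: a presheaf of `ℂ`-modules
`E p q U` with the differentials `∂` (`del`) and `∂̄` (`dbar`), satisfying `∂² = ∂̄² = 0`,
`∂∂̄ + ∂̄∂ = 0`, compatibility with restrictions, the sheaf gluing condition for pairs of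
open sets, and the softness property coming from `C^∞` partitions of unity (`pou`). -/
structure DoubleFormSheaf (X : Type u) [TopologicalSpace X] : Type (u + 1) where
  /-- the `ℂ`-module of `(p,q)`-forms on an open set `U` -/
  E : ℤ → ℤ → Opens X → ModuleCat.{u} ℂ
  /-- restriction of forms -/
  res : ∀ (p q : ℤ) ⦃U V : Opens X⦄, U ≤ V → ((E p q V) →ₗ[ℂ] (E p q U))
  res_refl : ∀ (p q : ℤ) (U : Opens X) (x : E p q U), res p q (le_refl U) x = x
  res_res : ∀ (p q : ℤ) ⦃U V W : Opens X⦄ (hUV : U ≤ V) (hVW : V ≤ W) (x : E p q W),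
      res p q hUV (res p q hVW x) = res p q (hUV.trans hVW) x
  /-- the differential `∂` -/
  del : ∀ (p q : ℤ) (U : Opens X), (E p q U) →ₗ[ℂ] (E (p + 1) q U)
  /-- the differential `∂̄` -/
  dbar : ∀ (p q : ℤ) (U : Opens X), (E p q U) →ₗ[ℂ] (E p (q + 1) U)
  del_del : ∀ (p q : ℤ) (U : Opens X) (x : E p q U), del (p + 1) q U (del p q U x) = 0
  dbar_dbar : ∀ (p q : ℤ) (U : Opens X) (x : E p q U), dbar p (q + 1) U (dbar p q U x) = 0
  del_dbar : ∀ (p q : ℤ) (U : Opens X) (x : E p q U),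
      del p (q + 1) U (dbar p q U x) + dbar (p + 1) q U (del p q U x) = 0
  res_del : ∀ (p q : ℤ) ⦃U V : Opens X⦄ (h : U ≤ V) (x : E p q V),
      del p q U (res p q h x) = res (p + 1) q h (del p q V x)
  res_dbar : ∀ (p q : ℤ) ⦃U V : Opens X⦄ (h : U ≤ V) (x : E p q V),
      dbar p q U (res p q h x) = res p (q + 1) h (dbar p q V x)
  /-- sheaf condition: forms agreeing on the overlap glue -/
  glue : ∀ (p q : ℤ) ⦃U V : Opens X⦄ (a : E p q U) (b : E p q V),
      res p q inf_le_left a = res p q inf_le_right b →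
      ∃! c : E p q (U ⊔ V), res p q le_sup_left c = a ∧ res p q le_sup_right c = b
  /-- softness coming from `C^∞` partitions of unity subordinate to a two-set open cover:
  "multiplication by `ρ₁` (resp. `ρ₀`) followed by extension by zero" operators. -/
  pou : ∀ ⦃U V : Opens X⦄, U ⊔ V = ⊤ →
      ∃ (z₀ : ∀ p q : ℤ, ((E p q (U ⊓ V)) →ₗ[ℂ] (E p q U)))
        (z₁ : ∀ p q : ℤ, ((E p q (U ⊓ V)) →ₗ[ℂ] (E p q V))),
        ∀ (p q : ℤ) (x : E p q (U ⊓ V)),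
          res p q inf_le_left (z₀ p q x) + res p q inf_le_right (z₁ p q x) = x

namespace DoubleFormSheaf

variable {X : Type u} [TopologicalSpace X] (F : DoubleFormSheaf X)

/-- identification of the modules of forms in equal bidegrees -/
def cast (U : Opens X) :
    ∀ {p q p' q' : ℤ}, p = p' → q = q' → ((F.E p q U) →ₗ[ℂ] (F.E p' q' U))
  | _, _, _, _, rfl, rfl => LinearMap.id

section Cech

variable (U₀ U₁ : Opens X)

/-- Čech–Bott–Chern cochains `E^{p,q}_{BC}(𝒰) = E^{p,q}(U₀) ⊕ E^{p,q}(U₁) ⊕ E^{p-1,q-1}(U₀₁)` -/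
abbrev TBC (p q : ℤ) : Type u :=
  ↥(F.E p q U₀) × ↥(F.E p q U₁) × ↥(F.E (p - 1) (q - 1) (U₀ ⊓ U₁))

/-- Čech–Aeppli cochains
`E^{p,q}_{A}(𝒰) = E^{p,q}(U₀) ⊕ E^{p,q}(U₁) ⊕ E^{(p-1,q-1)+1}(U₀₁)`,
`E^{(p-1,q-1)+1} = E^{p,q-1} ⊕ E^{p-1,q}` -/
abbrev TA (p q : ℤ) : Type u :=
  ↥(F.E p q U₀) × ↥(F.E p q U₁) ×
    (↥(F.E p (q - 1) (U₀ ⊓ U₁)) × ↥(F.E (p - 1) q (U₀ ⊓ U₁)))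

/-- Čech cochains of the third type
`E^{(p,q)+1}(𝒰) = E^{(p,q)+1}(U₀) ⊕ E^{(p,q)+1}(U₁) ⊕ E^{p,q}(U₀₁)`,
`E^{(p,q)+1} = E^{p+1,q} ⊕ E^{p,q+1}` -/
abbrev TT (p q : ℤ) : Type u :=
  (↥(F.E (p + 1) q U₀) × ↥(F.E p (q + 1) U₀)) ×
    (↥(F.E (p + 1) q U₁) × ↥(F.E p (q + 1) U₁)) × ↥(F.E p q (U₀ ⊓ U₁))

/-- Čech–Dolbeault cochains `E^{p,q}(𝒰) = E^{p,q}(U₀) ⊕ E^{p,q}(U₁) ⊕ E^{p,q-1}(U₀₁)` -/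
abbrev TD (p q : ℤ) : Type u :=
  ↥(F.E p q U₀) × ↥(F.E p q U₁) × ↥(F.E p (q - 1) (U₀ ⊓ U₁))

/-- relative Čech–Bott–Chern cochains `E^{p,q}_{BC}(𝒰, U₀) = E^{p,q}(U₁) ⊕ E^{p-1,q-1}(U₀₁)` -/
abbrev RBC (p q : ℤ) : Type u :=
  ↥(F.E p q U₁) × ↥(F.E (p - 1) (q - 1) (U₀ ⊓ U₁))

/-- relative Čech–Aeppli cochains `E^{p,q}_{A}(𝒰, U₀) = E^{p,q}(U₁) ⊕ E^{(p-1,q-1)+1}(U₀₁)` -/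
abbrev RA (p q : ℤ) : Type u :=
  ↥(F.E p q U₁) × (↥(F.E p (q - 1) (U₀ ⊓ U₁)) × ↥(F.E (p - 1) q (U₀ ⊓ U₁)))

/-- relative Čech cochains of the third type `E^{(p,q)+1}(𝒰, U₀) = E^{(p,q)+1}(U₁) ⊕ E^{p,q}(U₀₁)` -/
abbrev RT (p q : ℤ) : Type u :=
  (↥(F.E (p + 1) q U₁) × ↥(F.E p (q + 1) U₁)) × ↥(F.E p q (U₀ ⊓ U₁))

/-- relative Čech–Dolbeault cochains `E^{p,q}(𝒰, U₀) = E^{p,q}(U₁) ⊕ E^{p,q-1}(U₀₁)` -/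
abbrev RD (p q : ℤ) : Type u :=
  ↥(F.E p q U₁) × ↥(F.E p (q - 1) (U₀ ⊓ U₁))

/-- the Čech differential `E^{p,q}_{BC}(𝒰) → E^{(p,q)+1}(𝒰)`,
`σ ↦ ((∂σ₀, ∂̄σ₀), (∂σ₁, ∂̄σ₁), σ₁ - σ₀ - ∂̄∂σ₀₁)` (i.e. `σ ↦ (dσ₀, dσ₁, σ₁ - σ₀ - ∂̄∂σ₀₁)`) -/
def DtoTT (p q : ℤ) : TBC F U₀ U₁ p q →ₗ[ℂ] TT F U₀ U₁ p q :=
  lmTri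
    (LinearMap.prod ((F.del p q U₀).comp pA) ((F.dbar p q U₀).comp pA))
    (LinearMap.prod ((F.del p q U₁).comp pB) ((F.dbar p q U₁).comp pB))
    (((F.res p q inf_le_right).comp pB - (F.res p q inf_le_left).comp pA) -
      ((F.cast (U₀ ⊓ U₁) (show p - 1 + 1 = p by ring) (show q - 1 + 1 = q by ring)).comp
        ((F.dbar (p - 1 + 1) (q - 1) (U₀ ⊓ U₁)).comp
          ((F.del (p - 1) (q - 1) (U₀ ⊓ U₁)).comp pC))))

/-- the Čech differential `E^{(p,q)+1}(𝒰) → E^{p+1,q+1}_{A?}(𝒰)`; more precisely the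
differential `E^{(p,q)+1}(𝒰) → E^{p+1,q+1}(𝒰)`-component of the mixed complex, landing in
the Aeppli-type cochains `E^{p+1,q+1}_{A}(𝒰)`:
`((α₀,β₀), (α₁,β₁), γ) ↦ (∂̄α₀ + ∂β₀, ∂̄α₁ + ∂β₁, (α₁ - α₀ - ∂γ, β₁ - β₀ - ∂̄γ))` -/
def DtoTA (p q : ℤ) : TT F U₀ U₁ p q →ₗ[ℂ] TA F U₀ U₁ (p + 1) (q + 1) :=
  lmTri
    (((F.dbar (p + 1) q U₀).comp (qA.comp pA)) + ((F.del p (q + 1) U₀).comp (qB.comp pA)))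
    (((F.dbar (p + 1) q U₁).comp (qA.comp pB)) + ((F.del p (q + 1) U₁).comp (qB.comp pB)))
    (LinearMap.prod
      ((F.cast (U₀ ⊓ U₁) rfl (show q = q + 1 - 1 by ring)).comp
        (((F.res (p + 1) q inf_le_right).comp (qA.comp pB) -
            (F.res (p + 1) q inf_le_left).comp (qA.comp pA)) -
          ((F.del p q (U₀ ⊓ U₁)).comp pC)))
      ((F.cast (U₀ ⊓ U₁) (show p = p + 1 - 1 by ring) rfl).comp
        (((F.res p (q + 1) inf_le_right).comp (qB.comp pB) -
            (F.res p (q + 1) inf_le_left).comp (qB.comp pA)) -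
          ((F.dbar p q (U₀ ⊓ U₁)).comp pC))))

/-- the Čech differential `E^{p,q}_{A}(𝒰) → E^{p+1,q+1}_{BC}(𝒰)`:
`(ξ₀, ξ₁, (η₁, η₂)) ↦ (∂̄∂ξ₀, ∂̄∂ξ₁, ξ₁ - ξ₀ - ∂̄η₁ - ∂η₂)` -/
def DtoTBC (p q : ℤ) : TA F U₀ U₁ p q →ₗ[ℂ] TBC F U₀ U₁ (p + 1) (q + 1) :=
  lmTri
    ((F.dbar (p + 1) q U₀).comp ((F.del p q U₀).comp pA))
    ((F.dbar (p + 1) q U₁).comp ((F.del p q U₁).comp pB))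
    ((F.cast (U₀ ⊓ U₁) (show p = p + 1 - 1 by ring) (show q = q + 1 - 1 by ring)).comp
      ((((F.res p q inf_le_right).comp pB - (F.res p q inf_le_left).comp pA) -
          ((F.cast (U₀ ⊓ U₁) rfl (show q - 1 + 1 = q by ring)).comp
            ((F.dbar p (q - 1) (U₀ ⊓ U₁)).comp (qA.comp pC)))) -
        ((F.cast (U₀ ⊓ U₁) (show p - 1 + 1 = p by ring) rfl).comp
          ((F.del (p - 1) q (U₀ ⊓ U₁)).comp (qB.comp pC)))))

/-- the Čech–Dolbeault differential `∂̄ϑ σ = (∂̄σ₀, ∂̄σ₁, σ₁ - σ₀ - ∂̄σ₀₁)` -/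
def DD (p q : ℤ) : TD F U₀ U₁ p q →ₗ[ℂ] TD F U₀ U₁ p (q + 1) :=
  lmTri
    ((F.dbar p q U₀).comp pA)
    ((F.dbar p q U₁).comp pB)
    (((F.cast (U₀ ⊓ U₁) rfl (show q = q + 1 - 1 by ring)).comp
        ((F.res p q inf_le_right).comp pB - (F.res p q inf_le_left).comp pA)) -
      ((F.cast (U₀ ⊓ U₁) rfl (show q - 1 + 1 = q + 1 - 1 by ring)).comp
        ((F.dbar p (q - 1) (U₀ ⊓ U₁)).comp pC)))

/-- the relative Čech differential `E^{p,q}_{BC}(𝒰,U₀) → E^{(p,q)+1}(𝒰,U₀)` -/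
def RtoTT (p q : ℤ) : RBC F U₀ U₁ p q →ₗ[ℂ] RT F U₀ U₁ p q :=
  LinearMap.prod
    (LinearMap.prod ((F.del p q U₁).comp qA) ((F.dbar p q U₁).comp qA))
    (((F.res p q inf_le_right).comp qA) -
      ((F.cast (U₀ ⊓ U₁) (show p - 1 + 1 = p by ring) (show q - 1 + 1 = q by ring)).comp
        ((F.dbar (p - 1 + 1) (q - 1) (U₀ ⊓ U₁)).comp
          ((F.del (p - 1) (q - 1) (U₀ ⊓ U₁)).comp qB))))

/-- the relative Čech differential `E^{(p,q)+1}(𝒰,U₀) → E^{p+1,q+1}_{A}(𝒰,U₀)` -/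
def RtoTA (p q : ℤ) : RT F U₀ U₁ p q →ₗ[ℂ] RA F U₀ U₁ (p + 1) (q + 1) :=
  LinearMap.prod
    (((F.dbar (p + 1) q U₁).comp (qA.comp qA)) + ((F.del p (q + 1) U₁).comp (qB.comp qA)))
    (LinearMap.prod
      ((F.cast (U₀ ⊓ U₁) rfl (show q = q + 1 - 1 by ring)).comp
        (((F.res (p + 1) q inf_le_right).comp (qA.comp qA)) -
          ((F.del p q (U₀ ⊓ U₁)).comp qB)))
      ((F.cast (U₀ ⊓ U₁) (show p = p + 1 - 1 by ring) rfl).comp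
        (((F.res p (q + 1) inf_le_right).comp (qB.comp qA)) -
          ((F.dbar p q (U₀ ⊓ U₁)).comp qB))))

/-- the relative Čech differential `E^{p,q}_{A}(𝒰,U₀) → E^{p+1,q+1}_{BC}(𝒰,U₀)` -/
def RtoTBC (p q : ℤ) : RA F U₀ U₁ p q →ₗ[ℂ] RBC F U₀ U₁ (p + 1) (q + 1) :=
  LinearMap.prod
    ((F.dbar (p + 1) q U₁).comp ((F.del p q U₁).comp qA))
    ((F.cast (U₀ ⊓ U₁) (show p = p + 1 - 1 by ring) (show q = q + 1 - 1 by ring)).comp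
      ((((F.res p q inf_le_right).comp qA) -
          ((F.cast (U₀ ⊓ U₁) rfl (show q - 1 + 1 = q by ring)).comp
            ((F.dbar p (q - 1) (U₀ ⊓ U₁)).comp (qA.comp qB)))) -
        ((F.cast (U₀ ⊓ U₁) (show p - 1 + 1 = p by ring) rfl).comp
          ((F.del (p - 1) q (U₀ ⊓ U₁)).comp (qB.comp qB)))))

/-- the relative Čech–Dolbeault differential -/
def DrD (p q : ℤ) : RD F U₀ U₁ p q →ₗ[ℂ] RD F U₀ U₁ p (q + 1) :=
  LinearMap.prod
    ((F.dbar p q U₁).comp qA)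
    (((F.cast (U₀ ⊓ U₁) rfl (show q = q + 1 - 1 by ring)).comp
        ((F.res p q inf_le_right).comp qA)) -
      ((F.cast (U₀ ⊓ U₁) rfl (show q - 1 + 1 = q + 1 - 1 by ring)).comp
        ((F.dbar p (q - 1) (U₀ ⊓ U₁)).comp qB)))

/-- identification of Čech–Bott–Chern cochains in equal bidegrees -/
def castTBC {p q p' q' : ℤ} (hp : p = p') (hq : q = q') :
    TBC F U₀ U₁ p q →ₗ[ℂ] TBC F U₀ U₁ p' q' :=
  lmTri ((F.cast U₀ hp hq).comp pA) ((F.cast U₁ hp hq).comp pB)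
    ((F.cast _ (by rw [hp]) (by rw [hq])).comp pC)

/-- identification of Čech–Aeppli cochains in equal bidegrees -/
def castTA {p q p' q' : ℤ} (hp : p = p') (hq : q = q') :
    TA F U₀ U₁ p q →ₗ[ℂ] TA F U₀ U₁ p' q' :=
  lmTri ((F.cast U₀ hp hq).comp pA) ((F.cast U₁ hp hq).comp pB)
    (LinearMap.prod ((F.cast _ hp (by rw [hq])).comp (qA.comp pC))
      ((F.cast _ (by rw [hp]) hq).comp (qB.comp pC)))

/-- identification of Čech–Dolbeault cochains in equal bidegrees -/
def castTD {p q p' q' : ℤ} (hp : p = p') (hq : q = q') :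
    TD F U₀ U₁ p q →ₗ[ℂ] TD F U₀ U₁ p' q' :=
  lmTri ((F.cast U₀ hp hq).comp pA) ((F.cast U₁ hp hq).comp pB)
    ((F.cast _ hp (by rw [hq])).comp pC)

/-- identification of relative Čech–Bott–Chern cochains in equal bidegrees -/
def castRBC {p q p' q' : ℤ} (hp : p = p') (hq : q = q') :
    RBC F U₀ U₁ p q →ₗ[ℂ] RBC F U₀ U₁ p' q' :=
  LinearMap.prod ((F.cast U₁ hp hq).comp qA)
    ((F.cast _ (by rw [hp]) (by rw [hq])).comp qB)

/-- identification of relative Čech–Aeppli cochains in equal bidegrees -/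
def castRA {p q p' q' : ℤ} (hp : p = p') (hq : q = q') :
    RA F U₀ U₁ p q →ₗ[ℂ] RA F U₀ U₁ p' q' :=
  LinearMap.prod ((F.cast U₁ hp hq).comp qA)
    (LinearMap.prod ((F.cast _ hp (by rw [hq])).comp (qA.comp qB))
      ((F.cast _ (by rw [hp]) hq).comp (qB.comp qB)))

/-- identification of relative Čech–Dolbeault cochains in equal bidegrees -/
def castRD {p q p' q' : ℤ} (hp : p = p') (hq : q = q') :
    RD F U₀ U₁ p q →ₗ[ℂ] RD F U₀ U₁ p' q' :=
  LinearMap.prod ((F.cast U₁ hp hq).comp qA)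
    ((F.cast _ hp (by rw [hq])).comp qB)

/-- the Čech–Bott–Chern cohomology `H^{p,q}_{BC}(𝒰)` -/
abbrev HBCcech (p q : ℤ) : Type u :=
  cohomOf
    ((castTBC F U₀ U₁ (show p - 1 + 1 = p by ring) (show q - 1 + 1 = q by ring)).comp
      (DtoTBC F U₀ U₁ (p - 1) (q - 1)))
    (DtoTT F U₀ U₁ p q)

/-- the Čech–Aeppli cohomology `H^{p,q}_{A}(𝒰)` -/
abbrev HAcech (p q : ℤ) : Type u :=
  cohomOf
    ((castTA F U₀ U₁ (show p - 1 + 1 = p by ring) (show q - 1 + 1 = q by ring)).comp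
      (DtoTA F U₀ U₁ (p - 1) (q - 1)))
    (DtoTBC F U₀ U₁ p q)

/-- the Čech cohomology of the third type `H^{(p,q)+1}(𝒰)` -/
abbrev HTcech (p q : ℤ) : Type u :=
  cohomOf (DtoTT F U₀ U₁ p q) (DtoTA F U₀ U₁ p q)

/-- the Čech–Dolbeault cohomology `H^{p,q}_{∂̄ϑ}(𝒰)` -/
abbrev HDcech (p q : ℤ) : Type u :=
  cohomOf ((castTD F U₀ U₁ rfl (show q - 1 + 1 = q by ring)).comp (DD F U₀ U₁ p (q - 1)))
    (DD F U₀ U₁ p q)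

/-- the relative Bott–Chern cohomology `H^{p,q}_{BC}(𝒰, U₀)` -/
abbrev HBCrel (p q : ℤ) : Type u :=
  cohomOf
    ((castRBC F U₀ U₁ (show p - 1 + 1 = p by ring) (show q - 1 + 1 = q by ring)).comp
      (RtoTBC F U₀ U₁ (p - 1) (q - 1)))
    (RtoTT F U₀ U₁ p q)

/-- the relative Aeppli cohomology `H^{p,q}_{A}(𝒰, U₀)` -/
abbrev HArel (p q : ℤ) : Type u :=
  cohomOf
    ((castRA F U₀ U₁ (show p - 1 + 1 = p by ring) (show q - 1 + 1 = q by ring)).comp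
      (RtoTA F U₀ U₁ (p - 1) (q - 1)))
    (RtoTBC F U₀ U₁ p q)

/-- the relative cohomology of the third type `H^{(p,q)+1}(𝒰, U₀)` -/
abbrev HTrel (p q : ℤ) : Type u :=
  cohomOf (RtoTT F U₀ U₁ p q) (RtoTA F U₀ U₁ p q)

/-- the relative Dolbeault cohomology `H^{p,q}_{∂̄ϑ}(𝒰, U₀)` -/
abbrev HDrel (p q : ℤ) : Type u :=
  cohomOf ((castRD F U₀ U₁ rfl (show q - 1 + 1 = q by ring)).comp (DrD F U₀ U₁ p (q - 1)))
    (DrD F U₀ U₁ p q)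

end Cech

section OpenSet

variable (W : Opens X)

/-- the differential `∂̄ + ∂ : E^{(p-1,q-1)+1}(W) → E^{p,q}(W)`, `(η₁, η₂) ↦ ∂̄η₁ + ∂η₂` -/
def plusW (p q : ℤ) :
    (↥(F.E p (q - 1) W) × ↥(F.E (p - 1) q W)) →ₗ[ℂ] ↥(F.E p q W) :=
  ((F.cast W rfl (show q - 1 + 1 = q by ring)).comp ((F.dbar p (q - 1) W).comp qA)) +
    ((F.cast W (show p - 1 + 1 = p by ring) rfl).comp ((F.del (p - 1) q W).comp qB))

/-- the differential `∂̄∂ : E^{p,q}(W) → E^{p+1,q+1}(W)` -/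
def ddbarW (p q : ℤ) : ↥(F.E p q W) →ₗ[ℂ] ↥(F.E (p + 1) (q + 1) W) :=
  (F.dbar (p + 1) q W).comp (F.del p q W)

/-- the differential `d : E^{p,q}(W) → E^{(p,q)+1}(W)`, `ω ↦ (∂ω, ∂̄ω)` -/
def dfullW (p q : ℤ) :
    ↥(F.E p q W) →ₗ[ℂ] (↥(F.E (p + 1) q W) × ↥(F.E p (q + 1) W)) :=
  LinearMap.prod (F.del p q W) (F.dbar p q W)

/-- the differential `∂̄ + ∂ : E^{(p,q)+1}(W) → E^{p+1,q+1}(W)`, `(α, β) ↦ ∂̄α + ∂β` -/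
def plusTW (p q : ℤ) :
    (↥(F.E (p + 1) q W) × ↥(F.E p (q + 1) W)) →ₗ[ℂ] ↥(F.E (p + 1) (q + 1) W) :=
  ((F.dbar (p + 1) q W).comp qA) + ((F.del p (q + 1) W).comp qB)

/-- the Bott–Chern cohomology `H^{p,q}_{BC}(W)` of an open set `W` -/
abbrev HBCopen (p q : ℤ) : Type u :=
  cohomOf
    ((F.cast W (show p - 1 + 1 = p by ring) (show q - 1 + 1 = q by ring)).comp
      (ddbarW F W (p - 1) (q - 1)))
    (dfullW F W p q)

/-- the Aeppli cohomology `H^{p,q}_{A}(W)` of an open set `W` -/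
abbrev HAopen (p q : ℤ) : Type u :=
  cohomOf (plusW F W p q) (ddbarW F W p q)

/-- the cohomology of the third type `H^{(p,q)+1}(W)` of an open set `W` -/
abbrev HTopen (p q : ℤ) : Type u :=
  cohomOf (dfullW F W p q) (plusTW F W p q)

/-- the Dolbeault cohomology `H^{p,q}_{∂̄}(W)` of an open set `W` -/
abbrev HDopen (p q : ℤ) : Type u :=
  cohomOf ((F.cast W rfl (show q - 1 + 1 = q by ring)).comp (F.dbar p (q - 1) W))
    (F.dbar p q W)

end OpenSet

section Tilde

variable (U₀ U₁ : Opens X)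

/-- the map `ω ↦ (ω|_{U₀}, ω|_{U₁}, 0)` into Čech–Bott–Chern cochains -/
def tBC (p q : ℤ) : ↥(F.E p q ⊤) →ₗ[ℂ] TBC F U₀ U₁ p q :=
  lmTri (F.res p q le_top) (F.res p q le_top) 0

/-- the map `ω ↦ (ω|_{U₀}, ω|_{U₁}, 0, 0)` into Čech–Aeppli cochains -/
def tA (p q : ℤ) : ↥(F.E p q ⊤) →ₗ[ℂ] TA F U₀ U₁ p q :=
  lmTri (F.res p q le_top) (F.res p q le_top) 0

/-- the map `ω ↦ (ω|_{U₀}, ω|_{U₁}, 0)` into Čech–Dolbeault cochains -/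
def tD (p q : ℤ) : ↥(F.E p q ⊤) →ₗ[ℂ] TD F U₀ U₁ p q :=
  lmTri (F.res p q le_top) (F.res p q le_top) 0

end Tilde

end DoubleFormSheaf

open DoubleFormSheaf

section CohomMap

variable {A B C A' B' C' : Type u} [AddCommGroup A] [Module ℂ A] [AddCommGroup B] [Module ℂ B]
  [AddCommGroup C] [Module ℂ C] [AddCommGroup A'] [Module ℂ A'] [AddCommGroup B'] [Module ℂ B']
  [AddCommGroup C'] [Module ℂ C'] {f : A →ₗ[ℂ] B} {g : B →ₗ[ℂ] C} {f' : A' →ₗ[ℂ] B'}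
  {g' : B' →ₗ[ℂ] C'}

lemma cohomMk_eq_iff {b b' : B} (hb : g b = 0) (hb' : g b' = 0) :
    cohomMk f g b hb = cohomMk f g b' hb' ↔ ∃ a, f a = b - b' := by
  unfold cohomMk
  rw [Submodule.Quotient.eq]
  simp [Submodule.mem_comap, LinearMap.mem_range]

lemma exists_cohomMk (x : cohomOf f g) : ∃ b hb, x = cohomMk f g b hb := by
  obtain ⟨⟨b, hb⟩, rfl⟩ := Submodule.Quotient.mk_surjective _ x
  exact ⟨b, LinearMap.mem_ker.mp hb, rfl⟩

/-- A linear map preserving cocycles and coboundaries induces a linear map on cohomology. -/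
lemma exists_cohomMap (φ : B →ₗ[ℂ] B') (hker : ∀ b, g b = 0 → g' (φ b) = 0)
    (hrange : ∀ a, ∃ a', f' a' = φ (f a)) :
    ∃ Φ : cohomOf f g →ₗ[ℂ] cohomOf f' g',
      ∀ b hb, Φ (cohomMk f g b hb) = cohomMk f' g' (φ b) (hker b hb) := by
  refine ⟨Submodule.mapQ _ _ (φ.restrict (p := LinearMap.ker g) (q := LinearMap.ker g')
    fun b hb => LinearMap.mem_ker.mpr (hker b (LinearMap.mem_ker.mp hb))) ?_, fun b hb => rfl⟩
  rintro ⟨b, hb⟩ ⟨a, ha⟩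
  obtain ⟨a', ha'⟩ := hrange a
  refine ⟨a', ?_⟩
  rw [ha', ha]
  rfl

/-- A criterion for a map of complexes to induce an isomorphism on cohomology. -/
lemma exists_cohomEquiv (φ : B →ₗ[ℂ] B') (hker : ∀ b, g b = 0 → g' (φ b) = 0)
    (hrange : ∀ a, ∃ a', f' a' = φ (f a))
    (hinj : ∀ b, g b = 0 → ∀ a', f' a' = φ b → ∃ a, f a = b)
    (hsurj : ∀ b', g' b' = 0 → ∃ b, g b = 0 ∧ ∃ a', f' a' = φ b - b') :
    ∃ Φ : cohomOf f g ≃ₗ[ℂ] cohomOf f' g',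
      ∀ b hb, Φ (cohomMk f g b hb) = cohomMk f' g' (φ b) (hker b hb) := by
  obtain ⟨Φ, hΦ⟩ := exists_cohomMap φ hker hrange
  refine ⟨LinearEquiv.ofBijective Φ ⟨?_, fun y => ?_⟩, hΦ⟩
  · rw [injective_iff_map_eq_zero]
    intro x hx
    obtain ⟨b, hb, rfl⟩ := exists_cohomMk x
    have h0 : (0 : cohomOf f' g') = cohomMk f' g' 0 (map_zero g') := rfl
    rw [hΦ, h0, cohomMk_eq_iff] at hx
    obtain ⟨a', ha'⟩ := hx
    have h0' : (0 : cohomOf f g) = cohomMk f g 0 (map_zero g) := rfl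
    rw [h0', cohomMk_eq_iff]
    simpa using hinj b hb a' (by simpa using ha')
  · obtain ⟨b', hb', rfl⟩ := exists_cohomMk y
    obtain ⟨b, hb, ha⟩ := hsurj b' hb'
    exact ⟨cohomMk f g b hb, by rwa [hΦ, cohomMk_eq_iff]⟩

end CohomMap

namespace DoubleFormSheaf

variable {X : Type u} [TopologicalSpace X] (F : DoubleFormSheaf X)

section CastLemmas

variable {U V : Opens X} {p q p' q' : ℤ}

@[simp] lemma cast_rfl (hp : p = p) (hq : q = q) (x : F.E p q U) : F.cast U hp hq x = x := rfl

@[simp] lemma cast_cast {p'' q'' : ℤ} (hp : p = p') (hq : q = q') (hp' : p' = p'')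
    (hq' : q' = q'') (x : F.E p q U) :
    F.cast U hp' hq' (F.cast U hp hq x) = F.cast U (hp.trans hp') (hq.trans hq') x := by
  subst hp hq hp' hq'; rfl

lemma cast_injective (hp : p = p') (hq : q = q') : Function.Injective (F.cast U hp hq) := by
  subst hp hq; exact fun _ _ h => h

@[simp] lemma cast_eq_zero_iff (hp : p = p') (hq : q = q') (x : F.E p q U) :
    F.cast U hp hq x = 0 ↔ x = 0 := by
  subst hp hq; rfl

@[simp] lemma del_cast (hp : p = p') (hq : q = q') (x : F.E p q U) :
    F.del p' q' U (F.cast U hp hq x) = F.cast U (by rw [hp]) hq (F.del p q U x) := by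
  subst hp hq; rfl

@[simp] lemma dbar_cast (hp : p = p') (hq : q = q') (x : F.E p q U) :
    F.dbar p' q' U (F.cast U hp hq x) = F.cast U hp (by rw [hq]) (F.dbar p q U x) := by
  subst hp hq; rfl

@[simp] lemma res_cast (h : U ≤ V) (hp : p = p') (hq : q = q') (x : F.E p q V) :
    F.res p' q' h (F.cast V hp hq x) = F.cast U hp hq (F.res p q h x) := by
  subst hp hq; rfl

lemma del_dbar_eq (x : F.E p q U) :
    F.del p (q + 1) U (F.dbar p q U x) = -F.dbar (p + 1) q U (F.del p q U x) :=
  eq_neg_of_add_eq_zero_left (F.del_dbar p q U x)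

end CastLemmas

section Cover

variable {U₀ U₁ : Opens X} {p q : ℤ}

lemma ext_of_cover (h : U₀ ⊔ U₁ = ⊤) {x y : F.E p q ⊤}
    (h₀ : F.res p q (le_top : U₀ ≤ ⊤) x = F.res p q le_top y)
    (h₁ : F.res p q (le_top : U₁ ≤ ⊤) x = F.res p q le_top y) : x = y := by
  obtain ⟨c, -, hc⟩ := F.glue p q (U := U₀) (V := U₁) (F.res p q le_top x) (F.res p q le_top x)
    (by simp [F.res_res])
  have hxy : F.res p q (le_top : U₀ ⊔ U₁ ≤ ⊤) x = F.res p q le_top y :=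
    (hc _ ⟨by simp [F.res_res], by simp [F.res_res]⟩).trans
      (hc _ ⟨by simp [F.res_res, h₀], by simp [F.res_res, h₁]⟩).symm
  simpa [F.res_res, F.res_refl] using congrArg (F.res p q h.ge) hxy

lemma exists_glue_of_cover (h : U₀ ⊔ U₁ = ⊤) (a : F.E p q U₀) (b : F.E p q U₁)
    (hab : F.res p q inf_le_left a = F.res p q inf_le_right b) :
    ∃ c : F.E p q ⊤, F.res p q le_top c = a ∧ F.res p q le_top c = b := by
  obtain ⟨c, ⟨h₀, h₁⟩, -⟩ := F.glue p q a b hab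
  exact ⟨F.res p q h.ge c, by simpa [F.res_res] using h₀, by simpa [F.res_res] using h₁⟩

/-- The first Čech cohomology of a two-set cover with coefficients in `E^{p,q}` vanishes. -/
lemma exists_sub_of_cover (h : U₀ ⊔ U₁ = ⊤) (x : F.E p q (U₀ ⊓ U₁)) :
    ∃ (a : F.E p q U₀) (b : F.E p q U₁),
      x = F.res p q inf_le_right b - F.res p q inf_le_left a := by
  obtain ⟨z₀, z₁, hz⟩ := F.pou h
  exact ⟨-z₀ p q x, z₁ p q x, by rw [map_neg, sub_neg_eq_add, add_comm, hz]⟩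

end Cover

section Comparison

variable (U₀ U₁ : Opens X) (p q : ℤ)

/-- The cochain map `(σ₀, σ₁, σ₀₁) ↦ (σ₀, σ₁, ∂σ₀₁)`. -/
def bcToD : TBC F U₀ U₁ p q →ₗ[ℂ] TD F U₀ U₁ p q :=
  lmTri pA pB ((F.cast _ (show p - 1 + 1 = p by ring) rfl).comp
    ((F.del (p - 1) (q - 1) (U₀ ⊓ U₁)).comp pC))

/-- The relative cochain map `(σ₁, σ₀₁) ↦ (σ₁, ∂σ₀₁)`. -/
def relBCToD : RBC F U₀ U₁ p q →ₗ[ℂ] RD F U₀ U₁ p q :=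
  LinearMap.prod qA ((F.cast _ (show p - 1 + 1 = p by ring) rfl).comp
    ((F.del (p - 1) (q - 1) (U₀ ⊓ U₁)).comp qB))

variable {U₀ U₁ p q}

lemma DtoTT_eq_zero_iff (σ : TBC F U₀ U₁ p q) : DtoTT F U₀ U₁ p q σ = 0 ↔
    (F.del p q U₀ σ.1 = 0 ∧ F.dbar p q U₀ σ.1 = 0) ∧
    (F.del p q U₁ σ.2.1 = 0 ∧ F.dbar p q U₁ σ.2.1 = 0) ∧
    F.res p q inf_le_right σ.2.1 - F.res p q inf_le_left σ.1 -
      F.cast (U₀ ⊓ U₁) (show p - 1 + 1 = p by ring) (show q - 1 + 1 = q by ring)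
        (F.dbar (p - 1 + 1) (q - 1) _ (F.del (p - 1) (q - 1) _ σ.2.2)) = 0 := by
  simp [DtoTT, lmTri, pA, pB, pC, Prod.ext_iff]

lemma DD_eq_zero_iff (σ : TD F U₀ U₁ p q) : DD F U₀ U₁ p q σ = 0 ↔
    F.dbar p q U₀ σ.1 = 0 ∧ F.dbar p q U₁ σ.2.1 = 0 ∧
    F.res p q inf_le_right σ.2.1 - F.res p q inf_le_left σ.1 -
      F.cast (U₀ ⊓ U₁) rfl (show q - 1 + 1 = q by ring)
        (F.dbar p (q - 1) _ σ.2.2) = 0 := by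
  have key : ∀ (a : F.E p q (U₀ ⊓ U₁)) (b : F.E p (q - 1 + 1) (U₀ ⊓ U₁)),
      F.cast (U₀ ⊓ U₁) rfl (show q = q + 1 - 1 by ring) a -
        F.cast (U₀ ⊓ U₁) rfl (show q - 1 + 1 = q + 1 - 1 by ring) b = 0 ↔
      a - F.cast (U₀ ⊓ U₁) rfl (show q - 1 + 1 = q by ring) b = 0 := fun a b => by
    rw [← F.cast_eq_zero_iff rfl (show q = q + 1 - 1 by ring), map_sub, cast_cast]
  simp [DD, lmTri, pA, pB, pC, Prod.ext_iff, ← key]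

lemma RtoTT_eq_zero_iff (σ : RBC F U₀ U₁ p q) :
    RtoTT F U₀ U₁ p q σ = 0 ↔ DtoTT F U₀ U₁ p q (0, σ) = 0 := by
  simp [RtoTT, DtoTT, lmTri, pA, pB, pC, qA, qB, Prod.ext_iff]

lemma DrD_eq_zero_iff (σ : RD F U₀ U₁ p q) :
    DrD F U₀ U₁ p q σ = 0 ↔ DD F U₀ U₁ p q (0, σ) = 0 := by
  simp [DrD, DD, lmTri, pA, pB, pC, qA, qB, Prod.ext_iff]

lemma DD_bcToD_eq_zero (σ : TBC F U₀ U₁ p q) (hσ : DtoTT F U₀ U₁ p q σ = 0) :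
    DD F U₀ U₁ p q (bcToD F U₀ U₁ p q σ) = 0 := by
  rw [DtoTT_eq_zero_iff] at hσ
  obtain ⟨⟨-, h₀⟩, ⟨-, h₁⟩, h⟩ := hσ
  rw [DD_eq_zero_iff]
  exact ⟨h₀, h₁, by simpa [bcToD, lmTri, pA, pB, pC] using h⟩

lemma bcToD_coboundary (τ : TA F U₀ U₁ (p - 1) (q - 1)) :
    ((castTD F U₀ U₁ rfl (show q - 1 + 1 = q by ring)).comp (DD F U₀ U₁ p (q - 1)))
      (F.cast _ (show p - 1 + 1 = p by ring) rfl (F.del _ _ _ τ.1),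
        F.cast _ (show p - 1 + 1 = p by ring) rfl (F.del _ _ _ τ.2.1),
        -F.cast _ (show p - 1 + 1 = p by ring) rfl (F.del _ _ _ τ.2.2.1)) =
    bcToD F U₀ U₁ p q
      (((castTBC F U₀ U₁ (show p - 1 + 1 = p by ring) (show q - 1 + 1 = q by ring)).comp
        (DtoTBC F U₀ U₁ (p - 1) (q - 1))) τ) := by
  simp [bcToD, castTD, castTBC, DD, DtoTBC, lmTri, pA, pB, pC, qA, qB, F.del_del, F.del_dbar_eq,
    F.res_del]

lemma relBCToD_coboundary (τ : RA F U₀ U₁ (p - 1) (q - 1)) :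
    ((castRD F U₀ U₁ rfl (show q - 1 + 1 = q by ring)).comp (DrD F U₀ U₁ p (q - 1)))
      (F.cast _ (show p - 1 + 1 = p by ring) rfl (F.del _ _ _ τ.1),
        -F.cast _ (show p - 1 + 1 = p by ring) rfl (F.del _ _ _ τ.2.1)) =
    relBCToD F U₀ U₁ p q
      (((castRBC F U₀ U₁ (show p - 1 + 1 = p by ring) (show q - 1 + 1 = q by ring)).comp
        (RtoTBC F U₀ U₁ (p - 1) (q - 1))) τ) := by
  simp [relBCToD, castRD, castRBC, DrD, RtoTBC, qA, qB, F.del_del, F.del_dbar_eq,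
    F.res_del]

lemma DtoTT_tBC_eq_zero (ω : F.E p q ⊤) (hω : dfullW F ⊤ p q ω = 0) :
    DtoTT F U₀ U₁ p q (tBC F U₀ U₁ p q ω) = 0 := by
  have h : F.del p q ⊤ ω = 0 ∧ F.dbar p q ⊤ ω = 0 := by simpa [dfullW, Prod.ext_iff] using hω
  simp [DtoTT_eq_zero_iff, tBC, lmTri, F.res_del, F.res_dbar, F.res_res, h.1, h.2]

lemma DD_tD_eq_zero (ω : F.E p q ⊤) (hω : F.dbar p q ⊤ ω = 0) :
    DD F U₀ U₁ p q (tD F U₀ U₁ p q ω) = 0 := by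
  simp [DD_eq_zero_iff, tD, lmTri, F.res_dbar, F.res_res, hω]

lemma exists_bottChernEquiv (h : U₀ ⊔ U₁ = ⊤) :
    ∃ iso : HBCopen F (⊤ : Opens X) p q ≃ₗ[ℂ] HBCcech F U₀ U₁ p q,
      ∀ ω hω, iso (cohomMk _ (dfullW F ⊤ p q) ω hω)
        = cohomMk _ (DtoTT F U₀ U₁ p q) (tBC F U₀ U₁ p q ω) (F.DtoTT_tBC_eq_zero ω hω) := by
  refine exists_cohomEquiv (tBC F U₀ U₁ p q) F.DtoTT_tBC_eq_zero (fun τ => ?_)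
    (fun ω _ τ hτ => ?_) fun σ hσ => ?_
  · refine ⟨(F.res _ _ le_top τ, F.res _ _ le_top τ, 0), ?_⟩
    simp [castTBC, DtoTBC, tBC, ddbarW, lmTri, pA, pB, pC, qA, qB, F.res_del, F.res_dbar,
      F.res_res]
  · obtain ⟨τ₀, τ₁, η, θ⟩ := τ
    obtain ⟨η₀, η₁, rfl⟩ := F.exists_sub_of_cover h η
    obtain ⟨θ₀, θ₁, rfl⟩ := F.exists_sub_of_cover h θ
    simp [castTBC, DtoTBC, tBC, lmTri, pA, pB, pC, qA, qB, Prod.ext_iff, -map_sub] at hτ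
    obtain ⟨h₀, h₁, h₂⟩ := hτ
    obtain ⟨τ, ht₀, ht₁⟩ := F.exists_glue_of_cover h (τ₀ - plusW F _ _ _ (η₀, θ₀))
      (τ₁ - plusW F _ _ _ (η₁, θ₁)) (by
        simp [plusW, qA, qB, ← F.res_del, ← F.res_dbar] at h₂ ⊢
        rw [← sub_eq_zero, ← neg_eq_zero, ← h₂]
        abel)
    refine ⟨τ, F.ext_of_cover h ?_ ?_⟩
    · rw [← h₀]
      simp [ddbarW, ← F.res_del, ← F.res_dbar, ht₀, plusW, qA, qB, F.del_dbar_eq, F.del_del,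
        F.dbar_dbar]
    · rw [← h₁]
      simp [ddbarW, ← F.res_del, ← F.res_dbar, ht₁, plusW, qA, qB, F.del_dbar_eq, F.del_del,
        F.dbar_dbar]
  · obtain ⟨σ₀, σ₁, σ₀₁⟩ := σ
    obtain ⟨s₀, s₁, rfl⟩ := F.exists_sub_of_cover h σ₀₁
    rw [DtoTT_eq_zero_iff] at hσ
    obtain ⟨⟨ha₀, hb₀⟩, ⟨ha₁, hb₁⟩, hc⟩ := hσ
    dsimp only at ha₀ hb₀ ha₁ hb₁ hc
    obtain ⟨ω, hω₀, hω₁⟩ := F.exists_glue_of_cover h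
      (σ₀ - F.cast U₀ (show p - 1 + 1 = p by ring) (show q - 1 + 1 = q by ring)
        (ddbarW F _ _ _ s₀))
      (σ₁ - F.cast U₁ (show p - 1 + 1 = p by ring) (show q - 1 + 1 = q by ring)
        (ddbarW F _ _ _ s₁)) (by
        simp [ddbarW, ← F.res_del, ← F.res_dbar] at hc ⊢
        rw [← sub_eq_zero, ← neg_eq_zero, ← hc]
        abel)
    refine ⟨ω, ?_, (-s₀, -s₁, 0), ?_⟩
    · refine Prod.ext (F.ext_of_cover h ?_ ?_) (F.ext_of_cover h ?_ ?_)
      all_goals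
        simp [dfullW, ← F.res_del, ← F.res_dbar, hω₀, hω₁, ddbarW, ha₀, ha₁, hb₀, hb₁,
          F.del_dbar_eq, F.del_del, F.dbar_dbar]
    · simp [castTBC, DtoTBC, tBC, lmTri, pA, pB, pC, qA, qB, hω₀, hω₁, ddbarW]
      abel

lemma exists_dolbeaultEquiv (h : U₀ ⊔ U₁ = ⊤) :
    ∃ iso : HDopen F (⊤ : Opens X) p q ≃ₗ[ℂ] HDcech F U₀ U₁ p q,
      ∀ ω hω, iso (cohomMk _ (F.dbar p q ⊤) ω hω)
        = cohomMk _ (DD F U₀ U₁ p q) (tD F U₀ U₁ p q ω) (F.DD_tD_eq_zero ω hω) := by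
  refine exists_cohomEquiv (tD F U₀ U₁ p q) F.DD_tD_eq_zero (fun τ => ?_)
    (fun ω _ τ hτ => ?_) fun σ hσ => ?_
  · refine ⟨(F.res _ _ le_top τ, F.res _ _ le_top τ, 0), ?_⟩
    simp [castTD, DD, tD, lmTri, pA, pB, pC, F.res_dbar, F.res_res]
  · obtain ⟨τ₀, τ₁, η⟩ := τ
    obtain ⟨η₀, η₁, rfl⟩ := F.exists_sub_of_cover h η
    simp [castTD, DD, tD, lmTri, pA, pB, pC, Prod.ext_iff, -map_sub] at hτ
    obtain ⟨h₀, h₁, h₂⟩ := hτ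
    obtain ⟨τ, ht₀, ht₁⟩ := F.exists_glue_of_cover h
      (τ₀ - F.cast _ rfl (show q - 1 - 1 + 1 = q - 1 by ring) (F.dbar _ _ _ η₀))
      (τ₁ - F.cast _ rfl (show q - 1 - 1 + 1 = q - 1 by ring) (F.dbar _ _ _ η₁)) (by
        apply F.cast_injective rfl (show q - 1 = q - 1 + 1 - 1 by ring)
        simp [← F.res_dbar] at h₂ ⊢
        rw [← sub_eq_zero, ← neg_eq_zero, ← h₂]
        abel)
    refine ⟨τ, F.ext_of_cover h ?_ ?_⟩
    · rw [← h₀]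
      simp [← F.res_dbar, ht₀, F.dbar_dbar]
    · rw [← h₁]
      simp [← F.res_dbar, ht₁, F.dbar_dbar]
  · obtain ⟨σ₀, σ₁, σ₀₁⟩ := σ
    obtain ⟨s₀, s₁, rfl⟩ := F.exists_sub_of_cover h σ₀₁
    rw [DD_eq_zero_iff] at hσ
    obtain ⟨hb₀, hb₁, hc⟩ := hσ
    dsimp only at hb₀ hb₁ hc
    obtain ⟨ω, hω₀, hω₁⟩ := F.exists_glue_of_cover h
      (σ₀ - F.cast U₀ rfl (show q - 1 + 1 = q by ring) (F.dbar _ _ _ s₀))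
      (σ₁ - F.cast U₁ rfl (show q - 1 + 1 = q by ring) (F.dbar _ _ _ s₁)) (by
        simp [← F.res_dbar] at hc ⊢
        rw [← sub_eq_zero, ← neg_eq_zero, ← hc]
        abel)
    refine ⟨ω, F.ext_of_cover h ?_ ?_, (-s₀, -s₁, 0), ?_⟩
    · simp [← F.res_dbar, hω₀, hb₀, F.dbar_dbar]
    · simp [← F.res_dbar, hω₁, hb₁, F.dbar_dbar]
    · simp [castTD, DD, tD, lmTri, pA, pB, pC, hω₀, hω₁]
      abel

lemma exists_bottChernToDolbeault :
    ∃ ΦM : HBCopen F (⊤ : Opens X) p q →ₗ[ℂ] HDopen F (⊤ : Opens X) p q,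
      ∀ ω hω, ∃ h', ΦM (cohomMk _ (dfullW F ⊤ p q) ω hω) = cohomMk _ (F.dbar p q ⊤) ω h' := by
  obtain ⟨Φ, hΦ⟩ := exists_cohomMap
    (f := (F.cast ⊤ (show p - 1 + 1 = p by ring) (show q - 1 + 1 = q by ring)).comp
      (ddbarW F ⊤ (p - 1) (q - 1)))
    (g := dfullW F ⊤ p q)
    (f' := (F.cast ⊤ rfl (show q - 1 + 1 = q by ring)).comp (F.dbar p (q - 1) ⊤))
    (g' := F.dbar p q ⊤) LinearMap.id (fun ω hω => congrArg Prod.snd hω)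
    (fun τ => ⟨F.cast ⊤ (show p - 1 + 1 = p by ring) rfl (F.del _ _ _ τ), by simp [ddbarW]⟩)
  exact ⟨Φ, fun ω hω => ⟨_, hΦ ω hω⟩⟩

end Comparison

end DoubleFormSheaf

/-- Proposition 3.13 of the paper. -/
theorem statement8 {X : Type u} [TopologicalSpace X] (F : DoubleFormSheaf X)
    (S : Set X) (hS : IsClosed S) (U₁ : Opens X) (hU₁ : S ⊆ U₁) (p q : ℤ) :
    letI U₀ : Opens X := ⟨Sᶜ, hS.isOpen_compl⟩
    -- (1) the homomorphism `H^{p,q}_{BC}(𝒰) → H^{p,q}_{∂̄ϑ}(𝒰)`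
    (∃ Φ : HBCcech F U₀ U₁ p q →ₗ[ℂ] HDcech F U₀ U₁ p q,
      -- it is induced by `(σ₀, σ₁, σ₀₁) ↦ (σ₀, σ₁, ∂σ₀₁)`
      (∀ (σ : TBC F U₀ U₁ p q) (hσ : DtoTT F U₀ U₁ p q σ = 0),
        ∃ h', Φ (cohomMk _ (DtoTT F U₀ U₁ p q) σ hσ)
          = cohomMk _ (DD F U₀ U₁ p q)
              (σ.1, σ.2.1,
                F.cast _ (show p - 1 + 1 = p by ring) rfl
                  (F.del (p - 1) (q - 1) (U₀ ⊓ U₁) σ.2.2)) h') ∧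
      -- and it is compatible with the natural map `H^{p,q}_{BC}(M) → H^{p,q}_{∂̄}(M)`
      -- via the canonical isomorphisms with the Čech cohomologies:
      ∃ (isoBC : HBCopen F (⊤ : Opens X) p q ≃ₗ[ℂ] HBCcech F U₀ U₁ p q)
        (isoD : HDopen F (⊤ : Opens X) p q ≃ₗ[ℂ] HDcech F U₀ U₁ p q)
        (ΦM : HBCopen F (⊤ : Opens X) p q →ₗ[ℂ] HDopen F (⊤ : Opens X) p q),
        (∀ (ω : ↥(F.E p q ⊤)) (hω : dfullW F ⊤ p q ω = 0),
          ∃ h', isoBC (cohomMk _ (dfullW F ⊤ p q) ω hω)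
            = cohomMk _ (DtoTT F U₀ U₁ p q) (tBC F U₀ U₁ p q ω) h') ∧
        (∀ (ω : ↥(F.E p q ⊤)) (hω : F.dbar p q ⊤ ω = 0),
          ∃ h', isoD (cohomMk _ (F.dbar p q ⊤) ω hω)
            = cohomMk _ (DD F U₀ U₁ p q) (tD F U₀ U₁ p q ω) h') ∧
        (∀ (ω : ↥(F.E p q ⊤)) (hω : dfullW F ⊤ p q ω = 0),
          ∃ h', ΦM (cohomMk _ (dfullW F ⊤ p q) ω hω)
            = cohomMk _ (F.dbar p q ⊤) ω h') ∧
        (∀ x, Φ (isoBC x) = isoD (ΦM x))) ∧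
    -- (2) the relative homomorphism `H^{p,q}_{BC}(𝒰,U₀) → H^{p,q}_{∂̄ϑ}(𝒰,U₀)`
    (∃ Φrel : HBCrel F U₀ U₁ p q →ₗ[ℂ] HDrel F U₀ U₁ p q,
      ∀ (σ : RBC F U₀ U₁ p q) (hσ : RtoTT F U₀ U₁ p q σ = 0),
        ∃ h', Φrel (cohomMk _ (RtoTT F U₀ U₁ p q) σ hσ)
          = cohomMk _ (DrD F U₀ U₁ p q)
              (σ.1,
                F.cast _ (show p - 1 + 1 = p by ring) rfl
                  (F.del (p - 1) (q - 1) (U₀ ⊓ U₁) σ.2)) h') := by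
  have hU : (⟨Sᶜ, hS.isOpen_compl⟩ : Opens X) ⊔ U₁ = ⊤ := by
    ext x
    by_cases hx : x ∈ S
    · simp [hU₁ hx]
    · simp [hx]
  refine ⟨?_, ?_⟩
  · obtain ⟨Φ, hΦ⟩ := exists_cohomMap _ F.DD_bcToD_eq_zero
      fun τ => ⟨_, F.bcToD_coboundary (U₀ := ⟨Sᶜ, hS.isOpen_compl⟩) (U₁ := U₁) τ⟩
    obtain ⟨isoBC, hBC⟩ := F.exists_bottChernEquiv (p := p) (q := q) hU
    obtain ⟨isoD, hD⟩ := F.exists_dolbeaultEquiv (p := p) (q := q) hU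
    obtain ⟨ΦM, hM⟩ := F.exists_bottChernToDolbeault (p := p) (q := q)
    refine ⟨Φ, fun σ hσ => ⟨F.DD_bcToD_eq_zero σ hσ, hΦ σ hσ⟩, isoBC, isoD, ΦM,
      fun ω hω => ⟨_, hBC ω hω⟩, fun ω hω => ⟨_, hD ω hω⟩, hM, fun x => ?_⟩
    obtain ⟨ω, hω, rfl⟩ := exists_cohomMk x
    obtain ⟨h', hM'⟩ := hM ω hω
    rw [hBC, hΦ, hM', hD]
    congr 1
    simp [bcToD, tBC, tD, lmTri, pA, pB, pC]
  · have hker : ∀ σ : RBC F ⟨Sᶜ, hS.isOpen_compl⟩ U₁ p q, RtoTT F _ U₁ p q σ = 0 →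
        DrD F _ U₁ p q (relBCToD F _ U₁ p q σ) = 0 := fun σ hσ => by
      rw [RtoTT_eq_zero_iff] at hσ
      rw [DrD_eq_zero_iff]
      exact F.DD_bcToD_eq_zero _ hσ
    obtain ⟨Φ, hΦ⟩ := exists_cohomMap _ hker fun τ => ⟨_, F.relBCToD_coboundary τ⟩
    exact ⟨Φ, fun σ hσ => ⟨hker σ hσ, hΦ σ hσ⟩⟩
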